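/- arXiv:2602.04264 — 2 statements merged into one kernel-verified Lean document; each statement's English description precedes it below -/
import Mathlib

section
/- Let l < u be real numbers, n ≥ 1 a natural number, and c_0, …, c_n real coefficients. Define the scaled minimum and maximum coefficient differences m_min = (n/(u−l)) · min_{0 ≤ k ≤ n−1} (c_{k+1} − c_k) and m_max = (n/(u−l)) · max_{0 ≤ k ≤ n−1} (c_{k+1} − c_k). Then for every x ∈ [l,u], the derivative of the Bernstein activation satisfies m_min ≤ σ'(x) ≤ m_max. -/
/-- The Bernstein basis polynomial of degree `n`, index `k`, on the interval `[l, u]`. -/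
noncomputable def bernBasis (l u : ℝ) (n k : ℕ) (x : ℝ) : ℝ :=
  (n.choose k : ℝ) / (u - l) ^ n * (x - l) ^ k * (u - x) ^ (n - k)

/-- The Bernstein activation with coefficients `c 0, …, c n` on `[l, u]`. -/
noncomputable def bernAct (l u : ℝ) (n : ℕ) (c : ℕ → ℝ) (x : ℝ) : ℝ :=
  ∑ k ∈ Finset.range (n + 1), c k * bernBasis l u n k x

open Polynomial in
/-- The derivative of a polynomial in Bernstein form has as coefficients the scaled forward
differences of the original coefficients. -/
theorem derivative_sum_smul_bernsteinPolynomial {R : Type*} [CommRing R] (m : ℕ) (c : ℕ → R) :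
    derivative (∑ k ∈ Finset.range (m + 2), c k • bernsteinPolynomial R (m + 1) k) =
      (m + 1 : R[X]) *
        ∑ k ∈ Finset.range (m + 1), (c (k + 1) - c k) • bernsteinPolynomial R m k := by
  have hshift : ∑ k ∈ Finset.range (m + 1), c (k + 1) • bernsteinPolynomial R m (k + 1) +
      c 0 • bernsteinPolynomial R m 0 =
      ∑ k ∈ Finset.range (m + 1), c k • bernsteinPolynomial R m k := by
    rw [← Finset.sum_range_succ' (fun k => c k • bernsteinPolynomial R m k),
      Finset.sum_range_succ, bernsteinPolynomial.eq_zero_of_lt R (Nat.lt_succ_self m),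
      smul_zero, add_zero]
  simp only [sub_smul, Finset.sum_sub_distrib]
  rw [← hshift, Finset.sum_range_succ', derivative_add, derivative_sum]
  simp only [derivative_smul, bernsteinPolynomial.derivative_succ,
    bernsteinPolynomial.derivative_zero, Nat.add_sub_cancel, Nat.cast_add, Nat.cast_one,
    ← mul_smul_comm, smul_sub, mul_sub, mul_add, Finset.sum_sub_distrib, ← Finset.mul_sum,
    neg_mul, smul_neg]
  ring

theorem bernBasis_eq_eval {l u : ℝ} (hlu : l < u) {n k : ℕ} (hk : k ≤ n) (x : ℝ) :
    bernBasis l u n k x = (bernsteinPolynomial ℝ n k).eval ((x - l) / (u - l)) := by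
  have hd : u - l ≠ 0 := (sub_pos.mpr hlu).ne'
  have h1 : 1 - (x - l) / (u - l) = (u - x) / (u - l) := by
    field_simp
    ring
  obtain ⟨j, rfl⟩ := Nat.exists_eq_add_of_le hk
  simp only [bernBasis, bernsteinPolynomial, Polynomial.eval_mul, Polynomial.eval_pow,
    Polynomial.eval_sub, Polynomial.eval_one, Polynomial.eval_X, Polynomial.eval_natCast, h1,
    Nat.add_sub_cancel_left, div_pow, pow_add]
  field_simp

theorem bernAct_eq_eval {l u : ℝ} (hlu : l < u) (n : ℕ) (c : ℕ → ℝ) (x : ℝ) :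
    bernAct l u n c x =
      (∑ k ∈ Finset.range (n + 1), c k • bernsteinPolynomial ℝ n k).eval
        ((x - l) / (u - l)) := by
  rw [bernAct, Polynomial.eval_finsetSum]
  refine Finset.sum_congr rfl fun k hk => ?_
  rw [bernBasis_eq_eval hlu (Nat.lt_succ_iff.mp (Finset.mem_range.mp hk)),
    Polynomial.eval_smul, smul_eq_mul]

theorem hasDerivAt_bernAct_succ {l u : ℝ} (hlu : l < u) (m : ℕ) (c : ℕ → ℝ) (x : ℝ) :
    HasDerivAt (bernAct l u (m + 1) c)
      ((m + 1) / (u - l) * bernAct l u m (fun k => c (k + 1) - c k) x) x := by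
  have hinner : HasDerivAt (fun y : ℝ => (y - l) / (u - l)) (1 / (u - l)) x :=
    ((hasDerivAt_id x).sub_const l).div_const (u - l)
  have h := ((∑ k ∈ Finset.range (m + 2), c k • bernsteinPolynomial ℝ (m + 1) k).hasDerivAt
    ((x - l) / (u - l))).comp x hinner
  rw [derivative_sum_smul_bernsteinPolynomial] at h
  rw [funext (bernAct_eq_eval hlu (m + 1) c), bernAct_eq_eval hlu]
  refine h.congr_deriv ?_
  simp only [Polynomial.eval_mul, Polynomial.eval_add, Polynomial.eval_natCast,
    Polynomial.eval_one]
  ring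

theorem bernBasis_nonneg {l u x : ℝ} (hx : x ∈ Set.Icc l u) (n k : ℕ) :
    0 ≤ bernBasis l u n k x := by
  have h1 : 0 ≤ x - l := sub_nonneg.mpr hx.1
  have h2 : 0 ≤ u - x := sub_nonneg.mpr hx.2
  have h3 : 0 ≤ u - l := sub_nonneg.mpr (hx.1.trans hx.2)
  unfold bernBasis
  positivity

theorem bernAct_mono {l u x : ℝ} (hx : x ∈ Set.Icc l u) {n : ℕ} {c d : ℕ → ℝ}
    (h : ∀ k ∈ Finset.range (n + 1), c k ≤ d k) : bernAct l u n c x ≤ bernAct l u n d x :=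
  Finset.sum_le_sum fun k hk => mul_le_mul_of_nonneg_right (h k hk) (bernBasis_nonneg hx n k)

theorem bernAct_const {l u : ℝ} (hlu : l < u) (n : ℕ) (a x : ℝ) :
    bernAct l u n (fun _ => a) x = a := by
  rw [bernAct_eq_eval hlu, ← Finset.smul_sum, bernsteinPolynomial.sum, Polynomial.eval_smul,
    Polynomial.eval_one, smul_eq_mul, mul_one]

/-- with `m_min = (n/(u−l)) · min_k (c (k+1) − c k)` and
`m_max = (n/(u−l)) · max_k (c (k+1) − c k)`, for every `x ∈ [l,u]` one has
`m_min ≤ σ'(x) ≤ m_max`. -/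
theorem bernstein_deriv_two_sided_bound (l u : ℝ) (hlu : l < u) (n : ℕ) (hn : 1 ≤ n)
    (c : ℕ → ℝ) :
    ∀ x ∈ Set.Icc l u,
      (n / (u - l)) * (Finset.range n).inf'
          (Finset.nonempty_range_iff.mpr (by omega)) (fun k => c (k + 1) - c k)
        ≤ deriv (bernAct l u n c) x ∧
      deriv (bernAct l u n c) x ≤
        (n / (u - l)) * (Finset.range n).sup'
          (Finset.nonempty_range_iff.mpr (by omega)) (fun k => c (k + 1) - c k) := by
  intro x hx
  obtain ⟨m, rfl⟩ : ∃ m, n = m + 1 := ⟨n - 1, by omega⟩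
  have hpos : (0 : ℝ) ≤ ((m + 1 : ℕ) : ℝ) / (u - l) :=
    div_nonneg (Nat.cast_nonneg _) (sub_pos.mpr hlu).le
  rw [(hasDerivAt_bernAct_succ hlu m c x).deriv, ← Nat.cast_succ]
  constructor
  · refine mul_le_mul_of_nonneg_left ?_ hpos
    refine (bernAct_const hlu m _ x).symm.trans_le (bernAct_mono hx fun k hk => ?_)
    exact Finset.inf'_le (fun k => c (k + 1) - c k) hk
  · refine mul_le_mul_of_nonneg_left ?_ hpos
    refine (bernAct_mono hx fun k hk => ?_).trans_eq (bernAct_const hlu m _ x)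
    exact Finset.le_sup' (fun k => c (k + 1) - c k) hk
end

section
/- (Strict Monotonicity.) Let l < u be real numbers, n ≥ 1 a natural number, δ > 0, and c_0, …, c_n real coefficients satisfying c_{k+1} − c_k ≥ δ for every k ∈ {0,…,n−1}. Then the Bernstein activation σ is strictly monotone increasing on the interval [l,u]: for all x, y ∈ [l,u] with x < y, σ(x) < σ(y). -/
theorem bernBasis_eq_zero_of_lt (l u : ℝ) {n k : ℕ} (h : n < k) (x : ℝ) :
    bernBasis l u n k x = 0 := by
  simp [bernBasis, Nat.choose_eq_zero_of_lt h]

theorem bernBasis_succ_zero {l u : ℝ} (hlu : l < u) (n : ℕ) (x : ℝ) :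
    bernBasis l u (n + 1) 0 x = (u - x) / (u - l) * bernBasis l u n 0 x := by
  have h : u - l ≠ 0 := (sub_pos.2 hlu).ne'
  simp only [bernBasis, Nat.choose_zero_right, Nat.sub_zero, pow_succ]
  field_simp

/-- Pascal's rule for the Bernstein basis. -/
theorem bernBasis_succ_succ {l u : ℝ} (hlu : l < u) (n k : ℕ) (x : ℝ) :
    bernBasis l u (n + 1) (k + 1) x =
      (u - x) / (u - l) * bernBasis l u n (k + 1) x +
        (x - l) / (u - l) * bernBasis l u n k x := by
  have h : u - l ≠ 0 := (sub_pos.2 hlu).ne'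
  rcases lt_or_ge k n with hk | hk
  · obtain ⟨m, rfl⟩ := Nat.exists_eq_add_of_lt hk
    have h₁ : k + m + 1 + 1 - (k + 1) = m + 1 := by omega
    have h₂ : k + m + 1 - (k + 1) = m := by omega
    have h₃ : k + m + 1 - k = m + 1 := by omega
    simp only [bernBasis, h₁, h₂, h₃, Nat.choose_succ_succ' (k + m + 1) k, Nat.cast_add]
    field_simp
    ring
  · rw [bernBasis_eq_zero_of_lt l u (Nat.lt_succ_of_le hk)]
    rcases hk.eq_or_lt with rfl | hk
    · simp only [bernBasis, Nat.choose_self, Nat.sub_self]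
      field_simp
      ring
    · rw [bernBasis_eq_zero_of_lt l u hk, bernBasis_eq_zero_of_lt l u (Nat.succ_lt_succ hk)]
      ring

/-- De Casteljau's recursion. -/
theorem bernAct_succ {l u : ℝ} (hlu : l < u) (n : ℕ) (c : ℕ → ℝ) (x : ℝ) :
    bernAct l u (n + 1) c x =
      (u - x) / (u - l) * bernAct l u n c x +
        (x - l) / (u - l) * bernAct l u n (fun k => c (k + 1)) x := by
  have h : bernAct l u n c x =
      ∑ k ∈ Finset.range (n + 1), c (k + 1) * bernBasis l u n (k + 1) x +
        c 0 * bernBasis l u n 0 x := by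
    rw [← Finset.sum_range_succ' (fun k => c k * bernBasis l u n k x),
      Finset.sum_range_succ _ (n + 1), bernBasis_eq_zero_of_lt l u n.lt_succ_self]
    simp [bernAct]
  rw [h, bernAct, Finset.sum_range_succ', bernBasis_succ_zero hlu]
  simp only [bernBasis_succ_succ hlu, bernAct, mul_add, Finset.sum_add_distrib, Finset.mul_sum,
    mul_left_comm]
  ring

theorem bernAct_zero (l u : ℝ) (c : ℕ → ℝ) (x : ℝ) : bernAct l u 0 c x = c 0 := by
  simp [bernAct, bernBasis]

theorem bernAct_sub (l u : ℝ) (n : ℕ) (c d : ℕ → ℝ) (x : ℝ) :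
    bernAct l u n (fun k => c k - d k) x = bernAct l u n c x - bernAct l u n d x := by
  simp [bernAct, sub_mul]

/-- A lower bound on the coefficients is a lower bound on the activation. -/
theorem le_bernAct {l u : ℝ} (hlu : l < u) {n : ℕ} {c : ℕ → ℝ} {a x : ℝ}
    (hc : ∀ k ≤ n, a ≤ c k) (hx : x ∈ Set.Icc l u) : a ≤ bernAct l u n c x := by
  induction n generalizing c with
  | zero => simpa [bernAct_zero] using hc 0 le_rfl
  | succ n ih =>
    have h : 0 < u - l := sub_pos.2 hlu
    have h₁ := ih (c := c) fun k hk => hc k (by omega)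
    have h₂ := ih (c := fun k => c (k + 1)) fun k hk => hc (k + 1) (by omega)
    have hs : (u - x) / (u - l) + (x - l) / (u - l) = 1 := by field_simp; ring
    rw [bernAct_succ hlu]
    calc a = (u - x) / (u - l) * a + (x - l) / (u - l) * a := by rw [← add_mul, hs, one_mul]
      _ ≤ _ := add_le_add
        (mul_le_mul_of_nonneg_left h₁ (div_nonneg (sub_nonneg.2 hx.2) h.le))
        (mul_le_mul_of_nonneg_left h₂ (div_nonneg (sub_nonneg.2 hx.1) h.le))

theorem bernAct_succ_sub {l u : ℝ} (hlu : l < u) (n : ℕ) (c : ℕ → ℝ) (x y : ℝ) :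
    bernAct l u (n + 1) c y - bernAct l u (n + 1) c x =
      (u - y) / (u - l) * (bernAct l u n c y - bernAct l u n c x) +
        (y - l) / (u - l) * (bernAct l u n (fun k => c (k + 1)) y -
          bernAct l u n (fun k => c (k + 1)) x) +
        (y - x) / (u - l) * bernAct l u n (fun k => c (k + 1) - c k) x := by
  rw [bernAct_succ hlu, bernAct_succ hlu, bernAct_sub l u n (fun k => c (k + 1)) c]
  ring

theorem bernAct_monotoneOn {l u : ℝ} (hlu : l < u) {n : ℕ} {c : ℕ → ℝ}
    (hc : ∀ k < n, 0 ≤ c (k + 1) - c k) : MonotoneOn (bernAct l u n c) (Set.Icc l u) := by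
  induction n generalizing c with
  | zero => intro x _ y _ _; simp [bernAct_zero]
  | succ n ih =>
    intro x hx y hy hxy
    have h : 0 < u - l := sub_pos.2 hlu
    have h₁ := ih (c := c) (fun k hk => hc k (by omega)) hx hy hxy
    have h₂ := ih (c := fun k => c (k + 1)) (fun k hk => hc (k + 1) (by omega)) hx hy hxy
    have h₃ := le_bernAct hlu (n := n) (c := fun k => c (k + 1) - c k)
      (fun k hk => hc k (by omega)) hx
    rw [← sub_nonneg, bernAct_succ_sub hlu]
    exact add_nonneg (add_nonneg
      (mul_nonneg (div_nonneg (sub_nonneg.2 hy.2) h.le) (sub_nonneg.2 h₁))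
      (mul_nonneg (div_nonneg (sub_nonneg.2 hy.1) h.le) (sub_nonneg.2 h₂)))
      (mul_nonneg (div_nonneg (sub_nonneg.2 hxy) h.le) h₃)

/-- Strict Monotonicity: if `c (k+1) − c k ≥ δ > 0` for all
`k ∈ {0,…,n−1}`, then the Bernstein activation is strictly monotone increasing on
`[l, u]`. -/
theorem bernstein_strict_mono (l u : ℝ) (hlu : l < u) (n : ℕ) (hn : 1 ≤ n)
    (δ : ℝ) (hδ : 0 < δ) (c : ℕ → ℝ) (hc : ∀ k < n, δ ≤ c (k + 1) - c k) :
    StrictMonoOn (bernAct l u n c) (Set.Icc l u) := by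
  obtain ⟨n, rfl⟩ := Nat.exists_eq_add_of_le' hn
  intro x hx y hy hxy
  have h : 0 < u - l := sub_pos.2 hlu
  have h₁ := bernAct_monotoneOn hlu (n := n) (c := c)
    (fun k hk => hδ.le.trans (hc k (by omega))) hx hy hxy.le
  have h₂ := bernAct_monotoneOn hlu (n := n) (c := fun k => c (k + 1))
    (fun k hk => hδ.le.trans (hc (k + 1) (by omega))) hx hy hxy.le
  have h₃ := le_bernAct hlu (n := n) (c := fun k => c (k + 1) - c k)
    (fun k hk => hc k (by omega)) hx
  rw [← sub_pos, bernAct_succ_sub hlu]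
  exact add_pos_of_nonneg_of_pos (add_nonneg
    (mul_nonneg (div_nonneg (sub_nonneg.2 hy.2) h.le) (sub_nonneg.2 h₁))
    (mul_nonneg (div_nonneg (sub_nonneg.2 hy.1) h.le) (sub_nonneg.2 h₂)))
    (mul_pos (div_pos (sub_pos.2 hxy) h) (hδ.trans_le h₃))
end
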